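/- arXiv:1205.0722 — 9 statements merged into one kernel-verified Lean document; each statement's English description precedes it below -/
import Mathlib

section
/- Let I = (Δ, ·^I) be an interpretation for generalized ALC, and define the complemented interpretation Ī by Δ^Ī = Δ, A^Ī = Δ \ A^I for every atomic concept A ∈ At, and R^Ī = R^I for every role R ∈ Rol. Then for every generalized ALC concept C, the extension of the dual concept in the complemented interpretation is the complement of the extension of C, i.e., (C^d)^Ī = Δ \ C^I. -/
/-- Generalized ALC concepts over atomic concepts `At` and roles `Rol`. -/
inductive GConcept (At : Type) (Rol : Type) : Type
  | atom : At → GConcept At Rol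
  | op : (n : ℕ) → ((Fin n → Bool) → Bool) → (Fin n → GConcept At Rol) → GConcept At Rol
  | ex : Rol → GConcept At Rol → GConcept At Rol
  | all : Rol → GConcept At Rol → GConcept At Rol

/-- An interpretation: nonempty domain, sets for atomic concepts, relations for roles. -/
structure Interp (At : Type) (Rol : Type) where
  Δ : Type
  nonempty : Nonempty Δ
  atomI : At → Set Δ
  roleI : Rol → Set (Δ × Δ)

attribute [local instance] Classical.propDecidable

/-- The extension of a generalized concept in an interpretation. -/
noncomputable def gext {At Rol : Type} (I : Interp At Rol) : GConcept At Rol → Set I.Δ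
  | .atom A => I.atomI A
  | .op _ f Cs => {x | f (fun i => decide (x ∈ gext I (Cs i))) = true}
  | .ex R C => {x | ∃ y, (x, y) ∈ I.roleI R ∧ y ∈ gext I C}
  | .all R C => {x | ∀ y, (x, y) ∈ I.roleI R → y ∈ gext I C}

/-- `I` satisfies every axiom of the TBox `T`. -/
def gsatT {At Rol : Type} (I : Interp At Rol) (T : Set (GConcept At Rol × GConcept At Rol)) : Prop :=
  ∀ ax ∈ T, gext I ax.1 ⊆ gext I ax.2

/-- The subsumption problem. -/
def GSUBS {At Rol : Type} (T : Set (GConcept At Rol × GConcept At Rol))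
    (C D : GConcept At Rol) : Prop :=
  ∀ I : Interp At Rol, gsatT I T → gext I C ⊆ gext I D

/-- The dual concept: dualize every Boolean operator, swap the quantifiers. -/
def GConcept.dual {At Rol : Type} : GConcept At Rol → GConcept At Rol
  | .atom A => .atom A
  | .op n f Cs => .op n (fun b => ! f (fun i => ! b i)) (fun i => (Cs i).dual)
  | .ex R C => .all R C.dual
  | .all R C => .ex R C.dual

/-- The complemented interpretation: complement every atomic concept, keep domain and roles. -/
def Interp.compl {At Rol : Type} (I : Interp At Rol) : Interp At Rol :=
  ⟨I.Δ, I.nonempty, fun A => (I.atomI A)ᶜ, I.roleI⟩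

/-- the extension of the dual concept in the complemented interpretation
is the complement of the extension of the concept. -/
theorem dual_ext_compl {At Rol : Type} (I : Interp At Rol) (C : GConcept At Rol) :
    gext I.compl C.dual = (gext I C)ᶜ := by
  induction C with
  | atom A => rfl
  | op n f Cs ih =>
    ext x
    have complement_mem (i : Fin n) :
        decide (x ∈ gext I.compl (Cs i).dual) = !decide (x ∈ gext I (Cs i)) := by
      rw [ih i, ← decide_not]
      exact decide_eq_decide.mpr Iff.rfl
    change (!f fun i => !decide (x ∈ gext I.compl (Cs i).dual)) = true ↔
      ¬f (fun i => decide (x ∈ gext I (Cs i))) = true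
    simp [complement_mem]
  | ex R C ih =>
    ext x
    change (∀ y, (x, y) ∈ I.roleI R → y ∈ gext I.compl C.dual) ↔
      ¬∃ y, (x, y) ∈ I.roleI R ∧ y ∈ gext I C
    rw [ih, not_exists]
    exact forall_congr' fun _ => not_and.symm
  | all R C ih =>
    ext x
    change (∃ y, (x, y) ∈ I.roleI R ∧ y ∈ gext I.compl C.dual) ↔
      ¬∀ y, (x, y) ∈ I.roleI R → y ∈ gext I C
    rw [ih, not_forall]
    exact exists_congr fun _ => Classical.not_imp.symm
end

section
/- (Simulating the constants with negation.) Let T be a TBox and C, D concepts of generalized ALC whose operators include the 0-ary constants ⊤ (the constant-true operator) and ⊥ (the constant-false operator) and the unary negation operator ¬. Let t be an atomic concept not occurring in T, C or D, and let σ be the substitution that replaces every occurrence of ⊤ by t and every occurrence of ⊥ by ¬t (applied recursively throughout all concepts of T, C and D). Then (T, C, D) ∈ SUBS if and only if (σ(T) ∪ {¬t ⊑ t}, σ(C), σ(D)) ∈ SUBS. -/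
attribute [local instance] Classical.propDecidable

/-- The unary negation operator as a Boolean function. -/
def notOp : (Fin 1 → Bool) → Bool := fun b => ! b 0

/-- The concept `¬t` for an atomic concept `t`. -/
def negAtom {At Rol : Type} (t : At) : GConcept At Rol :=
  .op 1 notOp (fun _ => .atom t)

/-- The substitution `σ` replacing every occurrence of the 0-ary constant-true
operator `⊤` by the atomic concept `t` and every occurrence of the 0-ary
constant-false operator `⊥` by `¬t`. -/
def substConst {At Rol : Type} (t : At) : GConcept At Rol → GConcept At Rol
  | .atom A => .atom A
  | .op n f Cs =>
      if n = 0 then (if f (fun _ => true) then .atom t else negAtom t)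
      else .op n f (fun i => substConst t (Cs i))
  | .ex R C => .ex R (substConst t C)
  | .all R C => .all R (substConst t C)

/-- The atomic concept `t` occurs in the concept `C`. -/
def occursIn {At Rol : Type} (t : At) : GConcept At Rol → Prop
  | .atom A => A = t
  | .op _ _ Cs => ∃ i, occursIn t (Cs i)
  | .ex _ C => occursIn t C
  | .all _ C => occursIn t C

/-- When `t` denotes the whole domain, `substConst t` preserves extensions. -/
theorem gext_substConst {At Rol : Type} (I : Interp At Rol) (t : At)
    (ht : I.atomI t = Set.univ) (C : GConcept At Rol) :
    gext I (substConst t C) = gext I C := by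
  induction C with
  | atom A => rfl
  | op n f Cs ih =>
    by_cases hn : n = 0
    · subst hn
      have hf : ∀ b : Fin 0 → Bool, f b = f (fun _ => true) :=
        fun b => congrArg f (Subsingleton.elim _ _)
      ext x
      cases h : f (fun _ => true) <;>
        simp [substConst, negAtom, gext, notOp, ht, hf, h]
    · simp only [substConst, if_neg hn, gext, ih]
  | ex R C ih => simp only [substConst, gext, ih]
  | all R C ih => simp only [substConst, gext, ih]

/-- The interpretation `I` with the atomic concept `t` reinterpreted as the whole domain. -/
noncomputable def Interp.withUniv {At Rol : Type} (I : Interp At Rol) (t : At) :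
    Interp At Rol where
  Δ := I.Δ
  nonempty := I.nonempty
  atomI := Function.update I.atomI t Set.univ
  roleI := I.roleI

theorem Interp.withUniv_atomI_self {At Rol : Type} (I : Interp At Rol) (t : At) :
    (I.withUniv t).atomI t = Set.univ := by
  simp [Interp.withUniv]

theorem gext_withUniv {At Rol : Type} (I : Interp At Rol) (t : At) (C : GConcept At Rol)
    (hC : ¬ occursIn t C) : gext (I.withUniv t) C = gext I C := by
  induction C with
  | atom A => exact Function.update_of_ne hC Set.univ I.atomI
  | op n f Cs ih =>
    have h : ∀ i, gext (I.withUniv t) (Cs i) = gext I (Cs i) :=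
      fun i => ih i fun hi => hC ⟨i, hi⟩
    simp only [gext, h]
    rfl
  | ex R C ih =>
    simp only [gext, ih hC]
    rfl
  | all R C ih =>
    simp only [gext, ih hC]
    rfl

theorem gext_negAtom_subset_iff {At Rol : Type} (I : Interp At Rol) (t : At) :
    gext I (negAtom t) ⊆ gext I (.atom t) ↔ I.atomI t = Set.univ := by
  simp only [Set.subset_def, Set.eq_univ_iff_forall, negAtom, gext, notOp]
  refine forall_congr' fun x => ⟨fun h => ?_, fun h _ => h⟩
  by_contra hx
  refine hx (h ?_)
  change (! decide (x ∈ I.atomI t)) = true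
  rw [decide_eq_false hx, Bool.not_false]

/-- simulating the constants with negation: for `t` an atomic concept
not occurring in `T`, `C` or `D`, one has
`(T, C, D) ∈ SUBS` iff `(σ(T) ∪ {¬t ⊑ t}, σ(C), σ(D)) ∈ SUBS`. -/
theorem subs_simulate_constants {At Rol : Type}
    (T : Set (GConcept At Rol × GConcept At Rol)) (C D : GConcept At Rol) (t : At)
    (hT : ∀ ax ∈ T, ¬ occursIn t ax.1 ∧ ¬ occursIn t ax.2)
    (hC : ¬ occursIn t C) (hD : ¬ occursIn t D) :
    GSUBS T C D ↔
      GSUBS ((fun ax => (substConst t ax.1, substConst t ax.2)) '' T ∪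
          {(negAtom t, .atom t)})
        (substConst t C) (substConst t D) := by
  constructor
  · intro h I hI
    have ht : I.atomI t = Set.univ :=
      (gext_negAtom_subset_iff I t).1 (hI (negAtom t, .atom t) (Or.inr rfl))
    rw [gext_substConst I t ht, gext_substConst I t ht]
    refine h I fun ax hax => ?_
    have := hI _ (Or.inl ⟨ax, hax, rfl⟩)
    rwa [gext_substConst I t ht, gext_substConst I t ht] at this
  · intro h I hI
    have ht := I.withUniv_atomI_self t
    have key := h (I.withUniv t) ?_
    · rwa [gext_substConst _ t ht, gext_substConst _ t ht, gext_withUniv I t C hC,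
        gext_withUniv I t D hD] at key
    · rintro _ (⟨ax, hax, rfl⟩ | rfl)
      · rw [gext_substConst _ t ht, gext_substConst _ t ht, gext_withUniv I t _ (hT ax hax).1,
          gext_withUniv I t _ (hT ax hax).2]
        exact hI ax hax
      · exact (gext_negAtom_subset_iff _ t).2 ht
end

section
/- (Base independence of subsumption.) Let B₁, B₂ be sets of Boolean functions with [B₁] ⊆ [B₂], and let Q ⊆ {∃, ∀}. Then for every TBox T and concepts C, D of generalized ALC using only operators ∘_f with f ∈ B₁ and only quantifiers from Q, there exist a TBox T' and concepts C', D' using only operators ∘_g with g ∈ B₂ and only quantifiers from Q, such that for every interpretation I one has: I ⊨ T iff I ⊨ T', C^I = C'^I, and D^I = D'^I. In particular, (T, C, D) ∈ SUBS iff (T', C', D') ∈ SUBS. -/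
attribute [local instance] Classical.propDecidable

/-- The clone `[B]` generated by a set `B` of Boolean functions. -/
inductive InClone (B : (n : ℕ) → Set ((Fin n → Bool) → Bool)) :
    (n : ℕ) → ((Fin n → Bool) → Bool) → Prop
  | base {n : ℕ} {f : (Fin n → Bool) → Bool} : f ∈ B n → InClone B n f
  | proj {n : ℕ} (i : Fin n) : InClone B n (fun x => x i)
  | comp {n m : ℕ} {f : (Fin n → Bool) → Bool} {g : Fin n → ((Fin m → Bool) → Bool)} :
      InClone B n f → (∀ i, InClone B m (g i)) →
      InClone B m (fun x => f (fun i => g i x))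

/-- The two quantifiers of ALC. -/
inductive Quant : Type
  | ex : Quant
  | all : Quant

/-- A `B`-`Q`-concept: uses only Boolean operators from `B` and quantifiers from `Q`. -/
inductive GoodC (B : (n : ℕ) → Set ((Fin n → Bool) → Bool)) (Q : Set Quant) {At Rol : Type} :
    GConcept At Rol → Prop
  | atom (A : At) : GoodC B Q (.atom A)
  | op {n : ℕ} {f : (Fin n → Bool) → Bool} {Cs : Fin n → GConcept At Rol} :
      f ∈ B n → (∀ i, GoodC B Q (Cs i)) → GoodC B Q (.op n f Cs)
  | ex {R : Rol} {C : GConcept At Rol} :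
      Quant.ex ∈ Q → GoodC B Q C → GoodC B Q (.ex R C)
  | all {R : Rol} {C : GConcept At Rol} :
      Quant.all ∈ Q → GoodC B Q C → GoodC B Q (.all R C)

/-- Substituting concepts into a function of the clone `[B]` gives a concept expressible over `B`. -/
theorem InClone.exists_goodC {At Rol : Type} {B : (n : ℕ) → Set ((Fin n → Bool) → Bool)}
    {Q : Set Quant} {n : ℕ} {f : (Fin n → Bool) → Bool} (hf : InClone B n f)
    (Cs : Fin n → GConcept At Rol) (hCs : ∀ i, GoodC B Q (Cs i)) :
    ∃ C' : GConcept At Rol, GoodC B Q C' ∧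
      ∀ I : Interp At Rol, gext I (.op n f Cs) = gext I C' := by
  induction hf with
  | base hf => exact ⟨_, .op hf hCs, fun _ => rfl⟩
  | proj i => exact ⟨Cs i, hCs i, fun I => by ext x; simp [gext]⟩
  | comp _ _ ihf ihg =>
    choose Ds hDs hDsI using fun i => ihg i Cs hCs
    obtain ⟨C', hC', hC'I⟩ := ihf Ds hDs
    refine ⟨C', hC', fun I => ?_⟩
    rw [← hC'I]
    ext x
    simp [gext, ← hDsI]

/-- Translation of concepts along an inclusion of clones. -/
theorem GoodC.exists_equivalent {At Rol : Type} {B₁ B₂ : (n : ℕ) → Set ((Fin n → Bool) → Bool)}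
    {Q : Set Quant} (hB : ∀ n f, InClone B₁ n f → InClone B₂ n f)
    {C : GConcept At Rol} (hC : GoodC B₁ Q C) :
    ∃ C' : GConcept At Rol, GoodC B₂ Q C' ∧ ∀ I : Interp At Rol, gext I C = gext I C' := by
  induction hC with
  | atom A => exact ⟨_, .atom A, fun _ => rfl⟩
  | op hf _ ih =>
    choose Ds hDs hDsI using ih
    obtain ⟨C', hC', hC'I⟩ := (hB _ _ (.base hf)).exists_goodC Ds hDs
    refine ⟨C', hC', fun I => ?_⟩
    rw [← hC'I]
    simp only [gext, hDsI]
  | ex hq _ ih =>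
    obtain ⟨C', hC', hC'I⟩ := ih
    exact ⟨.ex _ C', .ex hq hC', fun I => by simp only [gext, hC'I]; rfl⟩
  | all hq _ ih =>
    obtain ⟨C', hC', hC'I⟩ := ih
    exact ⟨.all _ C', .all hq hC', fun I => by simp only [gext, hC'I]; rfl⟩

/-- base independence of subsumption: if `[B₁] ⊆ [B₂]`, then every
`B₁`-`Q`-instance of the subsumption problem can be replaced by a semantically
equivalent `B₂`-`Q`-instance. -/
theorem subs_base_independence {At Rol : Type}
    (B₁ B₂ : (n : ℕ) → Set ((Fin n → Bool) → Bool)) (Q : Set Quant)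
    (hB : ∀ n f, InClone B₁ n f → InClone B₂ n f)
    (T : Set (GConcept At Rol × GConcept At Rol)) (hTfin : T.Finite)
    (C D : GConcept At Rol)
    (hT : ∀ ax ∈ T, GoodC B₁ Q ax.1 ∧ GoodC B₁ Q ax.2)
    (hC : GoodC B₁ Q C) (hD : GoodC B₁ Q D) :
    ∃ (T' : Set (GConcept At Rol × GConcept At Rol)) (C' D' : GConcept At Rol),
      T'.Finite ∧
      (∀ ax ∈ T', GoodC B₂ Q ax.1 ∧ GoodC B₂ Q ax.2) ∧
      GoodC B₂ Q C' ∧ GoodC B₂ Q D' ∧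
      (∀ I : Interp At Rol,
        (gsatT I T ↔ gsatT I T') ∧ gext I C = gext I C' ∧ gext I D = gext I D') ∧
      (GSUBS T C D ↔ GSUBS T' C' D') := by
  have key : ∀ E : GConcept At Rol, ∃ E' : GConcept At Rol, GoodC B₁ Q E →
      GoodC B₂ Q E' ∧ ∀ I : Interp At Rol, gext I E = gext I E' := fun E => by
    by_cases hE : GoodC B₁ Q E
    · obtain ⟨E', hE'⟩ := hE.exists_equivalent hB
      exact ⟨E', fun _ => hE'⟩
    · exact ⟨E, fun h => absurd h hE⟩
  choose t ht using key
  have hsat : ∀ I : Interp At Rol,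
      gsatT I T ↔ gsatT I ((fun ax => (t ax.1, t ax.2)) '' T) := fun I => by
    rw [gsatT, gsatT, Set.forall_mem_image]
    refine forall₂_congr fun ax hax => ?_
    rw [(ht _ (hT ax hax).1).2 I, (ht _ (hT ax hax).2).2 I]
  refine ⟨(fun ax => (t ax.1, t ax.2)) '' T, t C, t D, hTfin.image _,
    Set.forall_mem_image.2 fun ax hax => ⟨(ht _ (hT ax hax).1).1, (ht _ (hT ax hax).2).1⟩,
    (ht C hC).1, (ht D hD).1, fun I => ⟨hsat I, (ht C hC).2 I, (ht D hD).2 I⟩, ?_⟩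
  refine forall_congr' fun I => ?_
  rw [hsat I, (ht C hC).2 I, (ht D hD).2 I]
end

section
/- (Propositional implication as subsumption with an empty TBox.) Let φ and ψ be propositional B-formulas over a set V of variables, and let ĉ be the translation mapping each variable x ∈ V to the atomic concept A_x and each formula g(φ₁,…,φₙ) to the concept ∘_g(ĉ(φ₁),…,ĉ(φₙ)). Then φ semantically implies ψ (i.e., for every assignment α : V → Bool, if φ evaluates to true under α then so does ψ) if and only if (∅, ĉ(φ), ĉ(ψ)) ∈ SUBS, i.e., if and only if ĉ(φ)^I ⊆ ĉ(ψ)^I for every interpretation I. -/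
attribute [local instance] Classical.propDecidable

/-- Propositional formulas built from variables by applications of Boolean functions. -/
inductive PropForm (V : Type) : Type
  | var : V → PropForm V
  | app : (n : ℕ) → ((Fin n → Bool) → Bool) → (Fin n → PropForm V) → PropForm V

/-- Evaluation of a propositional formula under an assignment. -/
def PropForm.eval {V : Type} (α : V → Bool) : PropForm V → Bool
  | .var x => α x
  | .app _ g φs => g (fun i => (φs i).eval α)

/-- The formula uses only Boolean functions from `B` (i.e., it is a `B`-formula). -/
def PropForm.usesOnly {V : Type} (B : (n : ℕ) → Set ((Fin n → Bool) → Bool)) :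
    PropForm V → Prop
  | .var _ => True
  | .app n g φs => g ∈ B n ∧ ∀ i, (φs i).usesOnly B

/-- The translation `ĉ` mapping each variable `x` to the atomic concept `A_x` and
each formula `g(φ₁,…,φₙ)` to the concept `∘_g(ĉ(φ₁),…,ĉ(φₙ))`. -/
def PropForm.toConcept {V Rol : Type} : PropForm V → GConcept V Rol
  | .var x => .atom x
  | .app n g φs => .op n g (fun i => (φs i).toConcept)

/-- If a point lies in exactly the atomic concepts made true by an assignment, it lies in the
extension of a translated formula iff the assignment satisfies the formula. -/
theorem PropForm.mem_gext_toConcept_iff {V Rol : Type} {I : Interp V Rol} {x : I.Δ}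
    {α : V → Bool} (hα : ∀ v, x ∈ I.atomI v ↔ α v = true) (φ : PropForm V) :
    x ∈ gext I φ.toConcept ↔ φ.eval α = true := by
  induction φ with
  | var v => exact hα v
  | app n g φs ih => simp [PropForm.toConcept, gext, PropForm.eval, ih]

/-- propositional implication as subsumption with an empty TBox:
`φ` semantically implies `ψ` iff `(∅, ĉ(φ), ĉ(ψ)) ∈ SUBS`. -/
theorem imp_iff_subs_empty {V Rol : Type} (B : (n : ℕ) → Set ((Fin n → Bool) → Bool))
    (φ ψ : PropForm V) (hφ : φ.usesOnly B) (hψ : ψ.usesOnly B) :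
    (∀ α : V → Bool, φ.eval α = true → ψ.eval α = true) ↔
      GSUBS (∅ : Set (GConcept V Rol × GConcept V Rol)) φ.toConcept ψ.toConcept := by
  constructor
  · intro h I _ x hx
    have hmem := PropForm.mem_gext_toConcept_iff (I := I) (x := x)
      (α := fun v => decide (x ∈ I.atomI v)) (fun v => by simp)
    exact (hmem ψ).2 (h _ ((hmem φ).1 hx))
  · intro h α hα
    let I : Interp V Rol := ⟨Unit, ⟨()⟩, fun v => {_x | α v = true}, fun _ => ∅⟩
    have hmem := PropForm.mem_gext_toConcept_iff (I := I) (x := ()) (α := α)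
      (fun _ => Iff.rfl)
    exact (hmem ψ).1 (h I (fun _ hax => hax.elim) ((hmem φ).2 hα))
end

section
/- (Propositional characterization of quantifier-free subsumption.) Let T be a TBox and C, D concepts of generalized ALC, all quantifier-free. Then (T, C, D) ∈ SUBS if and only if every assignment α : At → Bool such that (for every axiom E ⊑ F in T, ⟦E⟧α = true implies ⟦F⟧α = true) and ⟦C⟧α = true also satisfies ⟦D⟧α = true. -/
attribute [local instance] Classical.propDecidable

/-- A concept is quantifier-free if it contains no subconcept `∃R.C` or `∀R.C`. -/
def QFree {At Rol : Type} : GConcept At Rol → Prop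
  | .atom _ => True
  | .op _ _ Cs => ∀ i, QFree (Cs i)
  | .ex _ _ => False
  | .all _ _ => False

/-- The Boolean value `⟦C⟧α` of a quantifier-free concept under an assignment
`α : At → Bool` (the value on quantified concepts is irrelevant and arbitrary). -/
def gEval {At Rol : Type} (α : At → Bool) : GConcept At Rol → Bool
  | .atom A => α A
  | .op _ f Cs => f (fun i => gEval α (Cs i))
  | .ex _ _ => false
  | .all _ _ => false

/-- The extension of a quantifier-free concept is determined pointwise by its Boolean value. -/
theorem mem_gext_iff_gEval {At Rol : Type} (I : Interp At Rol) (x : I.Δ) (α : At → Bool)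
    (hα : ∀ A, x ∈ I.atomI A ↔ α A = true) (C : GConcept At Rol) (hC : QFree C) :
    x ∈ gext I C ↔ gEval α C = true := by
  induction C with
  | atom A => exact hα A
  | op n f Cs ih =>
    have h : (fun i => decide (x ∈ gext I (Cs i))) = fun i => gEval α (Cs i) := by
      funext i
      rw [Bool.eq_iff_iff, decide_eq_true_iff]
      exact ih i (hC i)
    change f (fun i => decide (x ∈ gext I (Cs i))) = true ↔ f (fun i => gEval α (Cs i)) = true
    rw [h]
  | ex R C _ => exact hC.elim
  | all R C _ => exact hC.elim

/-- The one-point interpretation with empty roles whose atoms are given by an assignment. -/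
def Interp.ofAssignment {At : Type} (Rol : Type) (α : At → Bool) : Interp At Rol where
  Δ := Unit
  nonempty := ⟨()⟩
  atomI A := {_x | α A = true}
  roleI _ := ∅

theorem mem_gext_ofAssignment {At Rol : Type} (α : At → Bool) (x : Unit)
    {C : GConcept At Rol} (hC : QFree C) :
    x ∈ gext (Interp.ofAssignment Rol α) C ↔ gEval α C = true :=
  mem_gext_iff_gEval (Interp.ofAssignment Rol α) x α (fun _ => Iff.rfl) C hC

/-- propositional characterization of quantifier-free subsumption:
for quantifier-free `T`, `C`, `D`: `(T, C, D) ∈ SUBS` iff every assignment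
satisfying all axioms of `T` and `C` also satisfies `D`. -/
theorem qfree_subs_iff {At Rol : Type} (T : Set (GConcept At Rol × GConcept At Rol))
    (C D : GConcept At Rol)
    (hT : ∀ ax ∈ T, QFree ax.1 ∧ QFree ax.2) (hC : QFree C) (hD : QFree D) :
    GSUBS T C D ↔
      ∀ α : At → Bool,
        (∀ ax ∈ T, gEval α ax.1 = true → gEval α ax.2 = true) →
        gEval α C = true → gEval α D = true := by
  constructor
  · intro h α hα hCα
    refine (mem_gext_ofAssignment α () hD).1 (h _ (fun ax hax x hx => ?_)
      ((mem_gext_ofAssignment α () hC).2 hCα))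
    exact (mem_gext_ofAssignment α x (hT ax hax).2).2
      (hα ax hax ((mem_gext_ofAssignment α x (hT ax hax).1).1 hx))
  · intro h I hI x hx
    have key := mem_gext_iff_gEval I x (fun A => decide (x ∈ I.atomI A))
      (fun _ => decide_eq_true_iff.symm)
    refine (key D hD).2 (h _ (fun ax hax hE => ?_) ((key C hC).1 hx))
    exact (key _ (hT ax hax).2).1 (hI ax hax ((key _ (hT ax hax).1).2 hE))
end

section
/- (Single-point models for quantifier-free satisfiability.) Let T be a TBox and C a concept of generalized ALC, all quantifier-free. Then C is satisfiable with respect to T (i.e., there exists an interpretation I with I ⊨ T and C^I ≠ ∅) if and only if there exists an assignment α : At → Bool such that ⟦C⟧α = true and, for every axiom E ⊑ F in T, ⟦E⟧α = true implies ⟦F⟧α = true. -/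
attribute [local instance] Classical.propDecidable

/-- Membership in the extension of a quantifier-free concept only depends on the atoms
that hold at the given point. -/
theorem QFree.mem_gext_iff {At Rol : Type} {I : Interp At Rol} {x : I.Δ} {α : At → Bool}
    (h : ∀ A, x ∈ I.atomI A ↔ α A = true) {C : GConcept At Rol} (hC : QFree C) :
    x ∈ gext I C ↔ gEval α C = true := by
  induction C with
  | atom A => exact h A
  | op n f Cs ih =>
    have hargs : (fun i => decide (x ∈ gext I (Cs i))) = fun i => gEval α (Cs i) := by
      funext i
      rw [Bool.eq_iff_iff, decide_eq_true_iff]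
      exact ih i (hC i)
    simp only [gext, gEval, Set.mem_ofPred_eq, hargs]
  | ex R C ih => exact hC.elim
  | all R C ih => exact hC.elim

/-- single-point models for quantifier-free satisfiability:
for quantifier-free `T` and `C`: `C` is satisfiable w.r.t. `T` iff some
assignment makes `C` true and satisfies all axioms of `T`. -/
theorem qfree_sat_iff {At Rol : Type} (T : Set (GConcept At Rol × GConcept At Rol))
    (C : GConcept At Rol)
    (hT : ∀ ax ∈ T, QFree ax.1 ∧ QFree ax.2) (hC : QFree C) :
    (∃ I : Interp At Rol, gsatT I T ∧ gext I C ≠ ∅) ↔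
      ∃ α : At → Bool, gEval α C = true ∧
        ∀ ax ∈ T, gEval α ax.1 = true → gEval α ax.2 = true := by
  constructor
  · rintro ⟨I, hI, hne⟩
    obtain ⟨x, hx⟩ := Set.nonempty_iff_ne_empty.mpr hne
    have h : ∀ A, x ∈ I.atomI A ↔ decide (x ∈ I.atomI A) = true := fun A =>
      decide_eq_true_iff.symm
    refine ⟨fun A => decide (x ∈ I.atomI A), (hC.mem_gext_iff h).mp hx, fun ax hax hE => ?_⟩
    exact ((hT ax hax).2.mem_gext_iff h).mp (hI ax hax (((hT ax hax).1.mem_gext_iff h).mpr hE))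
  · rintro ⟨α, hα, hax⟩
    let I : Interp At Rol := ⟨Unit, ⟨()⟩, fun A => {_x | α A = true}, fun _ => ∅⟩
    have h : ∀ (x : I.Δ) A, x ∈ I.atomI A ↔ α A = true := fun _ _ => Iff.rfl
    refine ⟨I, fun ax hmem x hx => ?_, Set.nonempty_iff_ne_empty.mp
      ⟨(), (hC.mem_gext_iff (h ())).mpr hα⟩⟩
    exact ((hT ax hmem).2.mem_gext_iff (h x)).mpr
      (hax ax hmem (((hT ax hmem).1.mem_gext_iff (h x)).mp hx))
end

section
/- (Hypergraph reachability as conjunctive subsumption.) Let H = (V, E) be a directed hypergraph whose hyperedges are triples (u₁, u₂; v) ∈ V × V × V, let s, t ∈ V, and for each vertex v ∈ V let A_v be a distinct atomic concept. Let T = { A_{u₁} ⊓ A_{u₂} ⊑ A_v | (u₁, u₂; v) ∈ E }. Then t ∈ Reach({s}) if and only if (T, A_s, A_t) ∈ SUBS. -/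
/-- Standard ALC concepts over atomic concepts `At` and roles `Rol`. -/
inductive AConcept (At : Type) (Rol : Type) : Type
  | atom : At → AConcept At Rol
  | top : AConcept At Rol
  | bot : AConcept At Rol
  | neg : AConcept At Rol → AConcept At Rol
  | inf : AConcept At Rol → AConcept At Rol → AConcept At Rol
  | sup : AConcept At Rol → AConcept At Rol → AConcept At Rol
  | ex : Rol → AConcept At Rol → AConcept At Rol
  | all : Rol → AConcept At Rol → AConcept At Rol

/-- The extension of an ALC concept in an interpretation. -/
def aext {At Rol : Type} (I : Interp At Rol) : AConcept At Rol → Set I.Δ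
  | .atom A => I.atomI A
  | .top => Set.univ
  | .bot => ∅
  | .neg C => (aext I C)ᶜ
  | .inf C D => aext I C ∩ aext I D
  | .sup C D => aext I C ∪ aext I D
  | .ex R C => {x | ∃ y, (x, y) ∈ I.roleI R ∧ y ∈ aext I C}
  | .all R C => {x | ∀ y, (x, y) ∈ I.roleI R → y ∈ aext I C}

/-- `I` satisfies every axiom of the TBox `T`. -/
def asatT {At Rol : Type} (I : Interp At Rol) (T : Set (AConcept At Rol × AConcept At Rol)) : Prop :=
  ∀ ax ∈ T, aext I ax.1 ⊆ aext I ax.2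

/-- The subsumption problem. -/
def ASUBS {At Rol : Type} (T : Set (AConcept At Rol × AConcept At Rol))
    (C D : AConcept At Rol) : Prop :=
  ∀ I : Interp At Rol, asatT I T → aext I C ⊆ aext I D

/-- Hyperreachability: the smallest set containing `S` and closed under the
hyperedges `(u₁, u₂; v)`. -/
inductive Reach {V : Type} (E : Set (V × V × V)) (S : Set V) : V → Prop
  | base {v : V} : v ∈ S → Reach E S v
  | step {u₁ u₂ v : V} : (u₁, u₂, v) ∈ E → Reach E S u₁ → Reach E S u₂ → Reach E S v

/-- hypergraph reachability as conjunctive subsumption: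
with `T = { A_{u₁} ⊓ A_{u₂} ⊑ A_v | (u₁,u₂;v) ∈ E }`,
`t ∈ Reach({s})` iff `(T, A_s, A_t) ∈ SUBS`. -/
theorem hgap_iff_subs {V At Rol : Type} (E : Set (V × V × V)) (s t : V)
    (A : V → At) (hA : Function.Injective A) :
    Reach E {s} t ↔
      ASUBS
        ((fun e : V × V × V =>
            ((AConcept.inf (.atom (A e.1)) (.atom (A e.2.1)) : AConcept At Rol),
              (.atom (A e.2.2) : AConcept At Rol))) '' E)
        (.atom (A s)) (.atom (A t)) := by
  constructor
  · intro h I hI x hx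
    induction h with
    | base hv =>
      obtain rfl := hv
      exact hx
    | step he _ _ ih₁ ih₂ => exact hI _ ⟨_, he, rfl⟩ ⟨ih₁, ih₂⟩
  · intro h
    let I : Interp At Rol :=
      { Δ := Unit
        nonempty := inferInstance
        atomI := fun a => {_x | ∃ v, A v = a ∧ Reach E {s} v}
        roleI := fun _ => ∅ }
    have mem_atom (v : V) (x : I.Δ) : x ∈ aext I (.atom (A v)) ↔ Reach E {s} v :=
      ⟨fun ⟨_, hw, hr⟩ => hA hw ▸ hr, fun hr => ⟨v, rfl, hr⟩⟩
    have hI : asatT I ((fun e : V × V × V =>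
        ((AConcept.inf (.atom (A e.1)) (.atom (A e.2.1)) : AConcept At Rol),
          (.atom (A e.2.2) : AConcept At Rol))) '' E) := by
      rintro _ ⟨e, he, rfl⟩ x ⟨h₁, h₂⟩
      exact (mem_atom _ x).2 (.step he ((mem_atom _ x).1 h₁) ((mem_atom _ x).1 h₂))
    exact (mem_atom t ()).1 (h I hI ((mem_atom s ()).2 (.base rfl)))
end

section
/- (Hypergraph reachability as disjunctive subsumption, dual form.) Let H = (V, E) be a directed hypergraph whose hyperedges are triples (u₁, u₂; v) ∈ V × V × V, let s, t ∈ V, and for each vertex v ∈ V let A_v be a distinct atomic concept. Let T' = { A_v ⊑ A_{u₁} ⊔ A_{u₂} | (u₁, u₂; v) ∈ E }. Then t ∈ Reach({s}) if and only if (T', A_t, A_s) ∈ SUBS. -/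
/-- hypergraph reachability as disjunctive subsumption, dual form:
with `T' = { A_v ⊑ A_{u₁} ⊔ A_{u₂} | (u₁,u₂;v) ∈ E }`,
`t ∈ Reach({s})` iff `(T', A_t, A_s) ∈ SUBS`. -/
theorem hgap_iff_subs_dual {V At Rol : Type} (E : Set (V × V × V)) (s t : V)
    (A : V → At) (hA : Function.Injective A) :
    Reach E {s} t ↔
      ASUBS
        ((fun e : V × V × V =>
            ((.atom (A e.2.2) : AConcept At Rol),
              (AConcept.sup (.atom (A e.1)) (.atom (A e.2.1)) : AConcept At Rol))) '' E)
        (.atom (A t)) (.atom (A s)) := by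
  constructor
  · intro h I hI
    induction h with
    | base hv =>
      obtain rfl := Set.mem_singleton_iff.mp hv
      exact subset_rfl
    | step he _ _ ih₁ ih₂ =>
      exact (hI _ (Set.mem_image_of_mem _ he)).trans (Set.union_subset ih₁ ih₂)
  · intro h
    by_contra ht
    -- One-point countermodel: the atoms of exactly the unreachable vertices hold.
    let I : Interp At Rol :=
      { Δ := Unit
        nonempty := ⟨()⟩
        atomI := fun a => {_x | ∃ v, A v = a ∧ ¬ Reach E {s} v}
        roleI := fun _ => ∅ }
    have hI : asatT I ((fun e : V × V × V =>
            ((.atom (A e.2.2) : AConcept At Rol),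
              (AConcept.sup (.atom (A e.1)) (.atom (A e.2.1)) : AConcept At Rol))) '' E) := by
      rintro _ ⟨⟨u₁, u₂, v⟩, he, rfl⟩ x ⟨w, hw, hnw⟩
      obtain rfl := hA hw
      by_cases h₁ : Reach E {s} u₁
      · exact Or.inr ⟨u₂, rfl, fun h₂ => hnw (.step he h₁ h₂)⟩
      · exact Or.inl ⟨u₁, rfl, h₁⟩
    obtain ⟨v, hv, hnv⟩ := h I hI (show () ∈ aext I (.atom (A t)) from ⟨t, rfl, ht⟩)
    obtain rfl := hA hv
    exact hnv (.base rfl)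
end

section
/- (Implication-graph characterization of subsumption for literal TBoxes.) Let T be a TBox all of whose axioms have the form l ⊑ l' for literals l, l', and let C, D be literals. Define the relation ⇒ on literals by: l ⇒ l' iff (l ⊑ l') ∈ T or (comp(l') ⊑ comp(l)) ∈ T, and let ⇒* be its reflexive-transitive closure. Then (T, C, D) ∈ SUBS if and only if at least one of the following holds: (i) C ⇒* D; (ii) C ⇒* comp(C); (iii) comp(D) ⇒* D; (iv) there exists an atomic concept A with A ⇒* ¬A and ¬A ⇒* A. -/
/-- A literal: a pair `(b, A)` denoting the concept `A` if `b = true` and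
`¬A` if `b = false`. -/
def litC {At Rol : Type} : Bool × At → AConcept At Rol
  | (true, A) => .atom A
  | (false, A) => .neg (.atom A)

/-- The complement of a literal. -/
def compL {At : Type} (l : Bool × At) : Bool × At := (! l.1, l.2)

open Relation

theorem compL_compL {At : Type} (l : Bool × At) : compL (compL l) = l := by
  simp [compL]

/-- Contraposition for paths in a relation closed under contraposition of single steps. -/
theorem reflTransGen_compL {At : Type} {r : Bool × At → Bool × At → Prop}
    (hr : ∀ a b, r a b → r (compL b) (compL a)) {a b : Bool × At} (h : ReflTransGen r a b) :
    ReflTransGen r (compL b) (compL a) := by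
  induction h with
  | refl => exact .refl
  | tail _ hbc ih => exact ReflTransGen.head (hr _ _ hbc) ih

/-- A set of literals that is closed under `r` and contains no complementary pair. -/
structure IsConsistentClosed {At : Type} (r : Bool × At → Bool × At → Prop)
    (S : Set (Bool × At)) : Prop where
  closed : ∀ a b, r a b → a ∈ S → b ∈ S
  consistent : ∀ a ∈ S, compL a ∉ S

theorem IsConsistentClosed.mem_of_reflTransGen {At : Type} {r : Bool × At → Bool × At → Prop}
    {S : Set (Bool × At)} (hS : IsConsistentClosed r S) {a b : Bool × At}
    (h : ReflTransGen r a b) (ha : a ∈ S) : b ∈ S := by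
  induction h with
  | refl => exact ha
  | tail _ hbc ih => exact hS.closed _ _ hbc ih

/-- A consistent closed set can be enlarged by the literals reachable from `x`, provided `x`
does not reach its complement and its complement is not in the set. -/
theorem IsConsistentClosed.union_reachable {At : Type} {r : Bool × At → Bool × At → Prop}
    (hr : ∀ a b, r a b → r (compL b) (compL a)) {S : Set (Bool × At)}
    (hS : IsConsistentClosed r S) {x : Bool × At} (hx : ¬ ReflTransGen r x (compL x))
    (hxS : compL x ∉ S) : IsConsistentClosed r (S ∪ {y | ReflTransGen r x y}) where
  closed a b hab h := h.imp (hS.closed a b hab) fun h => ReflTransGen.tail h hab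
  consistent := by
    rintro a (ha | ha) (hb | hb)
    · exact hS.consistent a ha hb
    · have h := reflTransGen_compL hr hb
      rw [compL_compL] at h
      exact hxS (hS.mem_of_reflTransGen h ha)
    · exact hxS (hS.mem_of_reflTransGen (reflTransGen_compL hr ha) hb)
    · exact hx (ReflTransGen.trans hb (reflTransGen_compL hr ha))

/-- If no literal is equivalent to its complement, every consistent closed set of literals extends
to one that decides every atom. -/
theorem IsConsistentClosed.exists_complete {At : Type} {r : Bool × At → Bool × At → Prop}
    (hr : ∀ a b, r a b → r (compL b) (compL a))
    (hcyc : ∀ x, ReflTransGen r x (compL x) → ¬ ReflTransGen r (compL x) x)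
    {S : Set (Bool × At)} (hS : IsConsistentClosed r S) :
    ∃ M, S ⊆ M ∧ IsConsistentClosed r M ∧ ∀ x, x ∈ M ∨ compL x ∈ M := by
  obtain ⟨M, hSM, hM⟩ := zorn_subset_nonempty {S | IsConsistentClosed r S} (by
    intro C hC hchain _
    refine ⟨⋃₀ C, ⟨?_, ?_⟩, fun s hs => Set.subset_sUnion_of_mem hs⟩
    · rintro a b hab ⟨s, hs, ha⟩
      exact ⟨s, hs, (hC hs).closed a b hab ha⟩
    · rintro a ⟨s, hs, ha⟩ ⟨t, ht, hb⟩
      rcases hchain.total hs ht with h | h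
      · exact (hC ht).consistent a (h ha) hb
      · exact (hC hs).consistent a ha (h hb)) S hS
  have hMc : IsConsistentClosed r M := hM.prop
  have mem_of_not_reach : ∀ x, ¬ ReflTransGen r x (compL x) → compL x ∉ M → x ∈ M :=
    fun x hx hxM => hM.le_of_ge (hMc.union_reachable hr hx hxM) Set.subset_union_left
      (Or.inr .refl)
  refine ⟨M, hSM, hMc, fun x => ?_⟩
  by_contra! h
  by_cases hx : ReflTransGen r x (compL x)
  · refine h.2 (mem_of_not_reach (compL x) ?_ ?_) <;> rw [compL_compL]
    exacts [hcyc x hx, h.1]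
  · exact h.1 (mem_of_not_reach x hx h.2)

theorem mem_aext_litC_compL {At Rol : Type} (I : Interp At Rol) (l : Bool × At) (x : I.Δ) :
    x ∈ aext I (litC (compL l)) ↔ x ∉ aext I (litC l) := by
  rcases l with ⟨_ | _, A⟩ <;> simp [compL, litC, aext]

/-- The one-point interpretation in which an atom holds iff its positive literal is in `M`. -/
def pointInterp {At : Type} (Rol : Type) (M : Set (Bool × At)) : Interp At Rol where
  Δ := Unit
  nonempty := ⟨()⟩
  atomI A := {_x | (true, A) ∈ M}
  roleI _ := ∅

theorem mem_aext_pointInterp {At Rol : Type} {M : Set (Bool × At)}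
    (hcons : ∀ a ∈ M, compL a ∉ M) (hcompl : ∀ x, x ∈ M ∨ compL x ∈ M) (l : Bool × At)
    (x : (pointInterp Rol M).Δ) : x ∈ aext (pointInterp Rol M) (litC l) ↔ l ∈ M := by
  rcases l with ⟨_ | _, A⟩
  · exact ⟨(hcompl (true, A)).resolve_left, fun h h' => hcons _ h' h⟩
  · exact Iff.rfl

/-- implication-graph characterization of subsumption for literal
TBoxes: for a TBox `T = { l ⊑ l' | (l, l') ∈ L }` of literal axioms and
literals `c`, `d`, with `l ⇒ l'` iff `(l ⊑ l') ∈ T` or `(comp l' ⊑ comp l) ∈ T`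
and `⇒*` its reflexive-transitive closure: `(T, c, d) ∈ SUBS` iff
(i) `c ⇒* d`, or (ii) `c ⇒* comp c`, or (iii) `comp d ⇒* d`, or
(iv) some atomic `A` satisfies `A ⇒* ¬A` and `¬A ⇒* A`. -/
theorem literal_subs_iff {At Rol : Type} (L : Set ((Bool × At) × (Bool × At)))
    (c d : Bool × At) :
    ASUBS ((fun p => ((litC p.1 : AConcept At Rol), (litC p.2 : AConcept At Rol))) '' L)
        (litC c) (litC d) ↔
      (Relation.ReflTransGen (fun l l' => (l, l') ∈ L ∨ (compL l', compL l) ∈ L) c d ∨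
       Relation.ReflTransGen (fun l l' => (l, l') ∈ L ∨ (compL l', compL l) ∈ L) c (compL c) ∨
       Relation.ReflTransGen (fun l l' => (l, l') ∈ L ∨ (compL l', compL l) ∈ L) (compL d) d ∨
       ∃ A : At,
         Relation.ReflTransGen (fun l l' => (l, l') ∈ L ∨ (compL l', compL l) ∈ L)
           (true, A) (false, A) ∧
         Relation.ReflTransGen (fun l l' => (l, l') ∈ L ∨ (compL l', compL l) ∈ L)
           (false, A) (true, A)) := by
  set r : Bool × At → Bool × At → Prop :=
    fun l l' => (l, l') ∈ L ∨ (compL l', compL l) ∈ L with hrdef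
  have hr : ∀ a b, r a b → r (compL b) (compL a) := by
    intro a b h
    simp only [hrdef, compL_compL] at h ⊢
    exact h.symm
  constructor
  · intro hsub
    by_contra! h
    obtain ⟨hcd, hcc, hdd, hcyc⟩ := h
    have hcyc' : ∀ x, ReflTransGen r x (compL x) → ¬ ReflTransGen r (compL x) x := by
      rintro ⟨_ | _, A⟩ h₁ h₂
      exacts [hcyc A h₂ h₁, hcyc A h₁ h₂]
    have hempty : IsConsistentClosed r ∅ := ⟨by simp, by simp⟩
    have hS : IsConsistentClosed r
        ((∅ ∪ {y | ReflTransGen r c y}) ∪ {y | ReflTransGen r (compL d) y}) := by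
      refine (hempty.union_reachable hr hcc (by simp)).union_reachable hr ?_ ?_ <;>
        rw [compL_compL]
      · exact hdd
      · simpa using hcd
    obtain ⟨M, hSM, hM, hcompl⟩ := hS.exists_complete hr hcyc'
    have hmem := mem_aext_pointInterp (Rol := Rol) hM.consistent hcompl
    have hsat : asatT (pointInterp Rol M)
        ((fun p => ((litC p.1 : AConcept At Rol), (litC p.2 : AConcept At Rol))) '' L) := by
      rintro _ ⟨p, hp, rfl⟩ x hx
      exact (hmem p.2 x).2 (hM.closed p.1 p.2 (Or.inl hp) ((hmem p.1 x).1 hx))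
    have hd : d ∈ M :=
      (hmem d ()).1 (hsub _ hsat ((hmem c ()).2 (hSM (Or.inl (Or.inr .refl)))))
    exact hM.consistent d hd (hSM (Or.inr .refl))
  · intro h I hI x hx
    have step : ∀ a b, r a b → x ∈ aext I (litC a) → x ∈ aext I (litC b) := by
      rintro a b (hab | hab) ha
      · exact hI _ ⟨_, hab, rfl⟩ ha
      · by_contra hb
        exact (mem_aext_litC_compL I a x).1
          (hI _ ⟨_, hab, rfl⟩ ((mem_aext_litC_compL I b x).2 hb)) ha
    have path : ∀ a b, ReflTransGen r a b → x ∈ aext I (litC a) → x ∈ aext I (litC b) := by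
      intro a b hab ha
      induction hab with
      | refl => exact ha
      | tail _ hbc ih => exact step _ _ hbc ih
    rcases h with h | h | h | ⟨A, h₁, h₂⟩
    · exact path _ _ h hx
    · exact absurd hx ((mem_aext_litC_compL I c x).1 (path _ _ h hx))
    · by_contra hd
      exact hd (path _ _ h ((mem_aext_litC_compL I d x).2 hd))
    · have hneg := mem_aext_litC_compL I (true, A) x
      by_cases hA : x ∈ aext I (litC (true, A))
      · exact absurd hA (hneg.1 (path _ _ h₁ hA))
      · exact absurd (path _ _ h₂ (hneg.2 hA)) hA
end
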